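/- Let k be an algebraically closed field of characteristic p > 0, let g ∈ k[X] be an additive polynomial (g(X) = Σ_i a_i X^{p^i}) with deg g ≥ 2, let c ∈ k, and let f(X) = g(X) + c. For a nonzero additive polynomial h write v_φ(h) = min{i : coefficient of X^{p^i} in h is nonzero}. Then for every n ≥ 1, the n-fold composite g^[n] satisfies g^[n](X) ≠ X and the number of elements z ∈ k with f^[n](z) = z equals (deg g)ⁿ / p^{v_φ(g^[n](X) − X)}. -/

import Mathlib

/-- The `φ`-adic valuation of an additive polynomial `h = Σ aᵢ X^(pⁱ)`:
the least `i` such that the coefficient of `X^(pⁱ)` is nonzero. -/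
noncomputable def phiVal {k : Type*} [Semiring k] (p : ℕ) (h : Polynomial k) : ℕ :=
  sInf {i : ℕ | h.coeff (p ^ i) ≠ 0}

open Polynomial in
/-- The `k`-submodule of polynomials all of whose exponents are powers of `p`. -/
def additivePolynomials (k : Type*) [CommSemiring k] (p : ℕ) : Submodule k k[X] where
  carrier := {h | ∀ i, h.coeff i ≠ 0 → ∃ j : ℕ, i = p ^ j}
  zero_mem' := fun i hi => absurd (coeff_zero i) hi
  add_mem' := by
    intro a b ha hb i hi
    by_cases h : a.coeff i = 0
    · exact hb i fun h' => hi (by rw [coeff_add, h, h', add_zero])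
    · exact ha i h
  smul_mem' := by
    intro c a ha i hi
    exact ha i fun h => hi (by rw [coeff_smul, h, smul_zero])

namespace additivePolynomials

open Polynomial

section CommSemiring

variable {k : Type*} [CommSemiring k] {p : ℕ}

theorem mem_iff {h : k[X]} :
    h ∈ additivePolynomials k p ↔ ∀ i, h.coeff i ≠ 0 → ∃ j : ℕ, i = p ^ j := Iff.rfl

theorem X_mem : (X : k[X]) ∈ additivePolynomials k p := by
  intro i hi
  refine ⟨0, ?_⟩
  by_contra h
  exact hi (coeff_X_of_ne_one (by simpa using h))

theorem eval_add [ExpChar k p] {g : k[X]} (hg : g ∈ additivePolynomials k p) (x y : k) :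
    g.eval (x + y) = g.eval x + g.eval y := by
  simp only [eval_eq_sum, Polynomial.sum, ← Finset.sum_add_distrib]
  refine Finset.sum_congr rfl fun i hi => ?_
  obtain ⟨j, rfl⟩ := hg i (mem_support_iff.1 hi)
  rw [add_pow_expChar_pow, mul_add]

theorem pow_mem [Fact p.Prime] [CharP k p] {h : k[X]} (hh : h ∈ additivePolynomials k p)
    (m : ℕ) : h ^ p ^ m ∈ additivePolynomials k p := by
  have hp : 0 < p ^ m := pow_pos (Fact.out : p.Prime).pos m
  intro i hi
  rw [← map_iterateFrobenius_expand p h m, coeff_map, coeff_expand hp] at hi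
  split_ifs at hi with hdvd
  · obtain ⟨j, hj⟩ := hh _ fun h0 => hi (by rw [h0, map_zero])
    exact ⟨j + m, by rw [pow_add, ← hj, Nat.div_mul_cancel hdvd]⟩
  · exact absurd (map_zero _) hi

theorem comp_mem [Fact p.Prime] [CharP k p] {g h : k[X]} (hg : g ∈ additivePolynomials k p)
    (hh : h ∈ additivePolynomials k p) : g.comp h ∈ additivePolynomials k p := by
  rw [comp, eval₂_eq_sum, Polynomial.sum]
  refine Submodule.sum_mem _ fun i hi => ?_
  obtain ⟨j, rfl⟩ := hg i (mem_support_iff.1 hi)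
  rw [← smul_eq_C_mul]
  exact Submodule.smul_mem _ _ (pow_mem hh j)

theorem iterate_comp_mem [Fact p.Prime] [CharP k p] {g : k[X]}
    (hg : g ∈ additivePolynomials k p) (n : ℕ) :
    (g.comp ·)^[n] X ∈ additivePolynomials k p := by
  induction n with
  | zero => exact X_mem
  | succ n ih =>
    rw [Function.iterate_succ_apply']
    exact comp_mem hg ih

theorem iterate_eval_add_C [ExpChar k p] {g : k[X]} (hg : g ∈ additivePolynomials k p)
    (c : k) (n : ℕ) :
    ∃ d : k, ∀ z, (fun z => (g + C c).eval z)^[n] z = ((g.comp ·)^[n] X).eval z + d := by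
  induction n with
  | zero => exact ⟨0, by simp⟩
  | succ n ih =>
    obtain ⟨d, hd⟩ := ih
    refine ⟨g.eval d + c, fun z => ?_⟩
    rw [Function.iterate_succ_apply', Function.iterate_succ_apply', hd, Polynomial.eval_add,
      eval_add hg, eval_C, eval_comp, add_assoc]

theorem coeff_phiVal_ne_zero {h : k[X]} (hh : h ∈ additivePolynomials k p) (h0 : h ≠ 0) :
    h.coeff (p ^ phiVal p h) ≠ 0 := by
  obtain ⟨j, hj⟩ := hh _ (leadingCoeff_ne_zero.2 h0)
  refine Nat.sInf_mem (s := {i : ℕ | h.coeff (p ^ i) ≠ 0}) ⟨j, ?_⟩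
  rw [Set.mem_ofPred_eq, ← hj]
  exact leadingCoeff_ne_zero.2 h0

/-- An additive polynomial `h` is a polynomial in `X ^ p ^ phiVal p h` whose derivative is a
nonzero constant. -/
theorem exists_expand [Fact p.Prime] [CharP k p] {h : k[X]}
    (hh : h ∈ additivePolynomials k p) (h0 : h ≠ 0) :
    ∃ r : k[X], expand k (p ^ phiVal p h) r = h ∧ ∃ a ≠ 0, derivative r = C a := by
  have hp : p.Prime := Fact.out
  set q := p ^ phiVal p h with hq
  have hq0 : q ≠ 0 := pow_ne_zero _ hp.ne_zero
  refine ⟨contract q h, ?_, h.coeff q, coeff_phiVal_ne_zero hh h0, ?_⟩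
  · ext i
    rw [coeff_expand (Nat.pos_of_ne_zero hq0)]
    split_ifs with hdvd
    · rw [coeff_contract hq0, Nat.div_mul_cancel hdvd]
    · by_contra hi
      obtain ⟨j, rfl⟩ := hh i (Ne.symm hi)
      exact hdvd (pow_dvd_pow p (Nat.sInf_le (Ne.symm hi)))
  · ext i
    rw [coeff_derivative, coeff_contract hq0, coeff_C]
    split_ifs with hi
    · simp [hi]
    · by_cases hc : h.coeff ((i + 1) * q) = 0
      · rw [hc, zero_mul]
      obtain ⟨j, hj⟩ := hh _ hc
      obtain ⟨m, -, hm⟩ := (Nat.dvd_prime_pow hp).1 (Dvd.intro _ hj)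
      have hm0 : m ≠ 0 := by
        rintro rfl
        exact hi (by simpa using hm)
      have : ((i + 1 : ℕ) : k) = 0 :=
        (CharP.cast_eq_zero_iff k p _).2 (hm ▸ dvd_pow_self p hm0)
      rw [← Nat.cast_succ, Nat.succ_eq_add_one, this, mul_zero]

end CommSemiring

theorem natDegree_iterate_comp_X {k : Type*} [Field k] (g : k[X]) (n : ℕ) :
    ((g.comp ·)^[n] X).natDegree = g.natDegree ^ n := by
  rw [natDegree_iterate_comp, natDegree_X, mul_one]

/-- The fibres of a nonzero additive polynomial `h` over an algebraically closed field all have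
`deg h / p ^ phiVal p h` elements. -/
theorem card_eval_add_eq_zero {k : Type*} [Field k] [IsAlgClosed k] {p : ℕ} [Fact p.Prime]
    [CharP k p] {h : k[X]} (hh : h ∈ additivePolynomials k p) (h0 : h ≠ 0) (d : k) :
    Nat.card {z : k | h.eval z + d = 0} = h.natDegree / p ^ phiVal p h := by
  classical
  have hp : p.Prime := Fact.out
  obtain ⟨r, hr, a, ha, hder⟩ := exists_expand hh h0
  have hdeg : h.natDegree / p ^ phiVal p h = (r + C d).natDegree := by
    conv_lhs => enter [1]; rw [← hr]
    rw [natDegree_expand, Nat.mul_div_cancel _ (pow_pos hp.pos _), natDegree_add_C]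
  have hder' : derivative (r + C d) = C a := by
    rw [derivative_add, derivative_C, add_zero, hder]
  have hsep : (r + C d).Separable := by
    rw [separable_def, hder']
    exact isCoprime_one_right.of_isCoprime_of_dvd_right (isUnit_C.2 ha.isUnit).dvd
  have hne : r + C d ≠ 0 := hsep.ne_zero
  have hcard : Nat.card (r + C d).roots.toFinset = (r + C d).natDegree := by
    rw [Nat.card_eq_fintype_card, Fintype.card_coe, Multiset.toFinset_card_of_nodup
      (nodup_roots hsep), (IsAlgClosed.splits (r + C d)).natDegree_eq_card_roots]
  rw [hdeg, ← hcard]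
  refine Nat.card_congr ((iterateFrobeniusEquiv k p (phiVal p h)).toEquiv.subtypeEquiv
    fun z => ?_)
  have hz : h.eval z = r.eval (z ^ p ^ phiVal p h) := by
    rw [← expand_eval, hr]
  simp [hne, hz, iterateFrobenius_def]

end additivePolynomials


/-- Periodic-point count for an affine morphism of `𝔾_a`: if `g` is an additive
polynomial of degree `≥ 2` over an algebraically closed field of characteristic
`p > 0` and `f = g + c`, then for every `n ≥ 1` the `n`-fold composite `g^[n]` is
`≠ X` and the number of `z ∈ k` with `f^[n](z) = z` equals
`(deg g)ⁿ / p^(v_φ(g^[n] − X))`. -/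
theorem additive_periodic_count
    {k : Type*} [Field k] [IsAlgClosed k] (p : ℕ) [Fact p.Prime] [CharP k p]
    (g : Polynomial k)
    (hadd : ∀ i : ℕ, g.coeff i ≠ 0 → ∃ j : ℕ, i = p ^ j)
    (hdeg : 2 ≤ g.natDegree)
    (c : k) (f : Polynomial k) (hf : f = g + Polynomial.C c)
    (n : ℕ) (hn : 1 ≤ n) :
    (g.comp ·)^[n] Polynomial.X ≠ Polynomial.X ∧
    Nat.card {z : k | (fun z => f.eval z)^[n] z = z}
      = g.natDegree ^ n / p ^ phiVal p ((g.comp ·)^[n] Polynomial.X - Polynomial.X) := by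
  subst hf
  replace hadd : g ∈ additivePolynomials k p := hadd
  set G := (g.comp ·)^[n] Polynomial.X with hG
  have hGdeg : G.natDegree = g.natDegree ^ n := additivePolynomials.natDegree_iterate_comp_X g n
  have hlt : (Polynomial.X : Polynomial k).natDegree < G.natDegree := by
    rw [hGdeg, Polynomial.natDegree_X]
    exact Nat.one_lt_pow (by omega) hdeg
  have hne : G ≠ Polynomial.X := fun h => by simp [h] at hlt
  refine ⟨hne, ?_⟩
  obtain ⟨d, hd⟩ := additivePolynomials.iterate_eval_add_C hadd c n
  rw [← hGdeg, ← Polynomial.natDegree_sub_eq_left_of_natDegree_lt hlt,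
    ← additivePolynomials.card_eval_add_eq_zero
      (Submodule.sub_mem _ (additivePolynomials.iterate_comp_mem hadd n)
        additivePolynomials.X_mem) (sub_ne_zero.2 hne) d]
  refine Nat.card_congr (Equiv.setCongr (Set.ext fun z => ?_))
  rw [Set.mem_ofPred_eq, Set.mem_ofPred_eq, hd, ← hG, ← sub_eq_zero, Polynomial.eval_sub,
    Polynomial.eval_X, sub_add_eq_add_sub]
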